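/- With the random hash functions h_1,…,h_s and sign functions φ_1,…,φ_s as in the context, fix x ∈ ℝ^d and define the cross term b := Σ_{i=1}^{k/s} Σ_{r=1}^{s} Σ_{j≠ℓ} x_j·x_ℓ·φ_r(j)·φ_r(ℓ)·1[h_r(j)=i]·1[h_r(ℓ)=i], where the inner sum is over ordered pairs (j,ℓ) ∈ {1,…,d}² with j ≠ ℓ. Then E[b²] = (2s²/k)·(‖x‖₂⁴ − ‖x‖₄⁴), where ‖x‖₄⁴ = Σ_{j=1}^d x_j⁴. -/

import Mathlib

open MeasureTheory ProbabilityTheory Finset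
open scoped ENNReal NNReal

/-- Uniform distribution on `{-1, +1} ⊆ ℝ` (law of a random sign `φ_r(j)`). -/
noncomputable def signMeasure : Measure ℝ :=
  ((2 : ℝ≥0)⁻¹) • Measure.dirac (-1) + ((2 : ℝ≥0)⁻¹) • Measure.dirac 1

instance : IsFiniteMeasure signMeasure := by unfold signMeasure; infer_instance

/-- Law of a single pair `(h_r(j), φ_r(j))`: `h_r(j)` uniform on `Fin c`, independently
`φ_r(j)` uniform on `{-1, +1}`. -/
noncomputable def hashSignMeasure (c : ℕ) [NeZero c] : Measure (Fin c × ℝ) :=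
  ((PMF.uniformOfFintype (Fin c)).toMeasure).prod signMeasure

/-- The `((i,r), j)` entry of the SJLT matrix given the realization `G` of all
hash/sign pairs: `S_{(i,r),j} = s^{-1/2} · φ_r(j) · 1[h_r(j) = i]`, where
`h_r(j) = (G (r,j)).1` and `φ_r(j) = (G (r,j)).2`. -/
noncomputable def sjltEntry {s c d : ℕ} (G : (Fin s × Fin d) → Fin c × ℝ)
    (i : Fin c) (r : Fin s) (j : Fin d) : ℝ :=
  (Real.sqrt s)⁻¹ * (G (r, j)).2 * (if (G (r, j)).1 = i then 1 else 0)

/-- The contribution of a pair of hash/sign values: the product of the signs if the hashes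
collide, and zero otherwise. -/
noncomputable def signedCollision {c : ℕ} (p q : Fin c × ℝ) : ℝ :=
  p.2 * q.2 * (if p.1 = q.1 then 1 else 0)

instance : IsProbabilityMeasure signMeasure := by
  constructor
  simp only [signMeasure, Measure.coe_add, Pi.add_apply, Measure.smul_apply, measure_univ,
    ENNReal.smul_def, smul_eq_mul, mul_one]
  rw [← ENNReal.coe_add, ← two_mul, mul_inv_cancel₀ two_ne_zero, ENNReal.coe_one]

instance (c : ℕ) [NeZero c] : IsProbabilityMeasure (hashSignMeasure c) := by
  unfold hashSignMeasure
  infer_instance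

theorem ae_signMeasure_sq : ∀ᵐ t ∂signMeasure, t ^ 2 = 1 := by
  have hm : MeasurableSet {t : ℝ | t ^ 2 = 1} := measurableSet_eq_fun (by fun_prop) (by fun_prop)
  rw [signMeasure, ae_add_measure_iff]
  constructor <;>
    exact Measure.ae_smul_measure ((ae_dirac_iff hm).2 (by norm_num)) _

theorem map_neg_signMeasure : signMeasure.map (fun t => -t) = signMeasure := by
  have hneg : Measurable fun t : ℝ => -t := measurable_neg
  rw [signMeasure, Measure.map_add _ _ hneg, Measure.map_smul, Measure.map_smul,
    Measure.map_dirac' hneg, Measure.map_dirac' hneg, neg_neg, add_comm]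

theorem ae_hashSignMeasure_sq (c : ℕ) [NeZero c] : ∀ᵐ p ∂hashSignMeasure c, p.2 ^ 2 = 1 :=
  Measure.quasiMeasurePreserving_snd.ae ae_signMeasure_sq

theorem measurePreserving_flip (c : ℕ) [NeZero c] :
    MeasurePreserving (fun p : Fin c × ℝ => (p.1, -p.2)) (hashSignMeasure c)
      (hashSignMeasure c) :=
  (MeasurePreserving.id _).prod ⟨measurable_neg, map_neg_signMeasure⟩

theorem integral_hashSignMeasure_sq_mul_indicator (c : ℕ) [NeZero c] (i : Fin c) :
    ∫ p, p.2 ^ 2 * (if p.1 = i then 1 else 0) ∂hashSignMeasure c = (c : ℝ)⁻¹ := by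
  have hae : (fun p : Fin c × ℝ => p.2 ^ 2 * (if p.1 = i then (1 : ℝ) else 0))
      =ᵐ[hashSignMeasure c] fun p => if p.1 = i then (1 : ℝ) else 0 := by
    filter_upwards [ae_hashSignMeasure_sq c] with p hp
    rw [hp, one_mul]
  rw [integral_congr_ae hae, hashSignMeasure,
    integral_fun_fst (μ := (PMF.uniformOfFintype (Fin c)).toMeasure) (ν := signMeasure)
      (fun a => if a = i then (1 : ℝ) else 0), PMF.integral_eq_sum]
  simp

theorem measurable_signedCollision {c : ℕ} :
    Measurable fun pq : (Fin c × ℝ) × (Fin c × ℝ) => signedCollision pq.1 pq.2 := by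
  unfold signedCollision
  refine Measurable.mul (by fun_prop) (Measurable.ite ?_ measurable_const measurable_const)
  exact measurableSet_eq_fun (by fun_prop) (by fun_prop)

theorem signedCollision_comm {c : ℕ} (p q : Fin c × ℝ) : signedCollision p q = signedCollision q p := by
  simp only [signedCollision, mul_comm p.2, eq_comm (a := p.1)]

theorem measurable_signedCollision_eval {ι : Type*} {c : ℕ} (u v : ι) :
    Measurable fun g : ι → Fin c × ℝ => signedCollision (g u) (g v) := by
  have h : Measurable fun g : ι → Fin c × ℝ => (g u, g v) := by fun_prop
  exact measurable_signedCollision.comp h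

section Product

variable {ι : Type*} [Fintype ι] {c : ℕ} [NeZero c]

theorem ae_pi_sq (u : ι) :
    ∀ᵐ g ∂Measure.pi (fun _ : ι => hashSignMeasure c), (g u).2 ^ 2 = 1 :=
  (measurePreserving_eval (fun _ : ι => hashSignMeasure c) u).quasiMeasurePreserving.ae
    (ae_hashSignMeasure_sq c)

theorem ae_abs_signedCollision_le (u v : ι) :
    ∀ᵐ g ∂Measure.pi (fun _ : ι => hashSignMeasure c), |signedCollision (g u) (g v)| ≤ 1 := by
  filter_upwards [ae_pi_sq (c := c) u, ae_pi_sq (c := c) v] with g hu hv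
  rw [← sq_le_one_iff_abs_le_one, signedCollision, mul_pow, mul_pow, hu, hv]
  split_ifs <;> norm_num

theorem integrable_signedCollision_mul (u v u' v' : ι) :
    Integrable (fun g : ι → Fin c × ℝ =>
      signedCollision (g u) (g v) * signedCollision (g u') (g v'))
      (Measure.pi fun _ => hashSignMeasure c) := by
  refine Integrable.of_bound (C := 1) ((measurable_signedCollision_eval u v).mul
    (measurable_signedCollision_eval u' v')).aestronglyMeasurable ?_
  filter_upwards [ae_abs_signedCollision_le (c := c) u v,
    ae_abs_signedCollision_le (c := c) u' v'] with g h h'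
  rw [Real.norm_eq_abs, abs_mul]
  exact mul_le_one₀ h (abs_nonneg _) h'

theorem integral_signedCollision_mul_self {u v : ι} (huv : u ≠ v) :
    ∫ g, signedCollision (g u) (g v) * signedCollision (g u) (g v)
      ∂Measure.pi (fun _ : ι => hashSignMeasure c) = (c : ℝ)⁻¹ := by
  set μ := Measure.pi (fun _ : ι => hashSignMeasure c)
  let f : Fin c → Fin c × ℝ → ℝ := fun i p => p.2 ^ 2 * (if p.1 = i then 1 else 0)
  have hf : ∀ i, Measurable (f i) := fun i =>
    Measurable.mul (by fun_prop) (Measurable.ite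
      (measurableSet_eq_fun (by fun_prop) (by fun_prop)) measurable_const measurable_const)
  have hfu : ∀ i w, Measurable fun g : ι → Fin c × ℝ => f i (g w) := fun i w =>
    (hf i).comp (measurable_pi_apply w)
  have hsum : ∀ g : ι → Fin c × ℝ, signedCollision (g u) (g v) * signedCollision (g u) (g v)
      = ∑ i, f i (g u) * f i (g v) := fun g => by
    simp only [f, signedCollision, mul_ite, mul_one, mul_zero, ite_mul, zero_mul]
    rw [Finset.sum_eq_single (g v).1] <;> simp +contextual [eq_comm]
    split_ifs <;> ring
  have hbound : ∀ i w, ∀ᵐ g ∂μ, |f i (g w)| ≤ 1 := fun i w => by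
    filter_upwards [ae_pi_sq (c := c) w] with g hg
    simp only [f, hg]
    split_ifs <;> norm_num
  have hint : ∀ i, Integrable (fun g => f i (g u) * f i (g v)) μ := fun i => by
    refine Integrable.of_bound (C := 1) ((hfu i u).mul (hfu i v)).aestronglyMeasurable ?_
    filter_upwards [hbound i u, hbound i v] with g h h'
    rw [Real.norm_eq_abs, abs_mul]
    exact mul_le_one₀ h (abs_nonneg _) h'
  have heval : ∀ i w, ∫ g, f i (g w) ∂μ = (c : ℝ)⁻¹ := fun i w => by
    have hp := measurePreserving_eval (fun _ : ι => hashSignMeasure c) w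
    have h := integral_map (μ := μ) (f := f i) hp.measurable.aemeasurable (hf i).aestronglyMeasurable
    rw [hp.map_eq, integral_hashSignMeasure_sq_mul_indicator c i] at h
    exact h.symm
  have hindep : ∀ i, IndepFun (fun g => f i (g u)) (fun g => f i (g v)) μ := fun i =>
    (iIndepFun_pi (μ := fun _ : ι => hashSignMeasure c) (X := fun _ => f i)
      fun _ => (hf i).aemeasurable).indepFun huv
  simp only [hsum]
  rw [integral_finsetSum _ fun i _ => hint i]
  have hc : (c : ℝ) ≠ 0 := Nat.cast_ne_zero.2 (NeZero.ne c)
  rw [Finset.sum_congr rfl fun i _ => (hindep i).integral_fun_mul_eq_mul_integral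
    (hfu i u).aestronglyMeasurable (hfu i v).aestronglyMeasurable]
  simp [heval, hc]

variable [DecidableEq ι]

/-- An index that occurs exactly once makes the expectation vanish, by flipping its sign. -/
theorem integral_signedCollision_mul_eq_zero {u v u' v' : ι} (huv : u ≠ v) (hu : u ≠ u')
    (hv : u ≠ v') :
    ∫ g, signedCollision (g u) (g v) * signedCollision (g u') (g v')
      ∂Measure.pi (fun _ : ι => hashSignMeasure c) = 0 := by
  set μ := Measure.pi (fun _ : ι => hashSignMeasure c)
  set F : (ι → Fin c × ℝ) → ℝ := fun g =>
    signedCollision (g u) (g v) * signedCollision (g u') (g v') with hF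
  let T : (ι → Fin c × ℝ) → (ι → Fin c × ℝ) := fun g m =>
    (if m = u then fun p : Fin c × ℝ => (p.1, -p.2) else id) (g m)
  have hT : MeasurePreserving T μ μ := by
    refine measurePreserving_pi _ _ fun m => ?_
    split_ifs
    exacts [measurePreserving_flip c, MeasurePreserving.id _]
  have hodd : ∀ g, F (T g) = -F g := fun g => by
    simp [hF, T, signedCollision, huv.symm, hu.symm, hv.symm]
    split_ifs <;> simp
  have hmeas : AEStronglyMeasurable F (μ.map T) :=
    ((measurable_signedCollision_eval u v).mul
      (measurable_signedCollision_eval u' v')).aestronglyMeasurable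
  have h := integral_map hT.measurable.aemeasurable hmeas
  simp only [hT.map_eq, hodd, integral_neg] at h
  linarith

theorem integral_signedCollision_mul {u v u' v' : ι} (huv : u ≠ v) (huv' : u' ≠ v') :
    ∫ g, signedCollision (g u) (g v) * signedCollision (g u') (g v')
      ∂Measure.pi (fun _ : ι => hashSignMeasure c)
      = (c : ℝ)⁻¹ * ((if u = u' ∧ v = v' then 1 else 0) + if u = v' ∧ v = u' then 1 else 0) := by
  by_cases h : u = u' ∧ v = v'
  · obtain ⟨rfl, rfl⟩ := h
    simp [integral_signedCollision_mul_self huv, huv]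
  by_cases h' : u = v' ∧ v = u'
  · obtain ⟨rfl, rfl⟩ := h'
    simp_rw [fun g : ι → Fin c × ℝ => signedCollision_comm (g v) (g u)]
    simp [integral_signedCollision_mul_self huv, huv]
  rw [if_neg h, if_neg h', add_zero, mul_zero]
  by_cases hu : u = u' ∨ u = v'
  · simp_rw [fun g : ι → Fin c × ℝ => signedCollision_comm (g u) (g v)]
    refine integral_signedCollision_mul_eq_zero huv.symm ?_ ?_ <;> grind
  · exact integral_signedCollision_mul_eq_zero huv (by tauto) (by tauto)

/-- Second moment of a weighted sum of signed collisions. -/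
theorem integral_sum_signedCollision_sq {α : Type*} [Fintype α] (u v : α → ι) (w : α → ℝ)
    (hw : ∀ a, u a = v a → w a = 0) :
    ∫ g, (∑ a, w a * signedCollision (g (u a)) (g (v a))) ^ 2
      ∂Measure.pi (fun _ : ι => hashSignMeasure c)
      = ∑ a, ∑ b, w a * w b * ((c : ℝ)⁻¹ * ((if u a = u b ∧ v a = v b then 1 else 0)
          + if u a = v b ∧ v a = u b then 1 else 0)) := by
  have hexp : ∀ g : ι → Fin c × ℝ, (∑ a, w a * signedCollision (g (u a)) (g (v a))) ^ 2
      = ∑ a, ∑ b, w a * w b * (signedCollision (g (u a)) (g (v a)) *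
          signedCollision (g (u b)) (g (v b))) := fun g => by
    rw [sq, Finset.sum_mul_sum]
    exact Finset.sum_congr rfl fun a _ => Finset.sum_congr rfl fun b _ => by ring
  have hint := fun a b =>
    (integrable_signedCollision_mul (c := c) (u a) (v a) (u b) (v b)).const_mul (w a * w b)
  simp only [hexp]
  rw [integral_finsetSum _ fun a _ => integrable_finsetSum _ fun b _ => hint a b]
  refine Finset.sum_congr rfl fun a _ => ?_
  rw [integral_finsetSum _ fun b _ => hint a b]
  refine Finset.sum_congr rfl fun b _ => ?_
  rw [integral_const_mul]
  by_cases ha : u a = v a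
  · simp [hw a ha]
  by_cases hb : u b = v b
  · simp [hw b hb]
  rw [integral_signedCollision_mul ha hb]

end Product

theorem crossTerm_eq_sum_signedCollision {s c d : ℕ} (g : Fin s × Fin d → Fin c × ℝ)
    (x : Fin d → ℝ) :
    (∑ i : Fin c, ∑ r : Fin s, ∑ j : Fin d, ∑ l : Fin d,
        if j ≠ l then
          x j * x l * (g (r, j)).2 * (g (r, l)).2
            * (if (g (r, j)).1 = i then 1 else 0)
            * (if (g (r, l)).1 = i then 1 else 0)
        else 0)
      = ∑ a : Fin s × Fin d × Fin d, (if a.2.1 ≠ a.2.2 then x a.2.1 * x a.2.2 else 0) *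
          signedCollision (g (a.1, a.2.1)) (g (a.1, a.2.2)) := by
  simp only [Fintype.sum_prod_type]
  rw [Finset.sum_comm]
  refine Finset.sum_congr rfl fun r _ => ?_
  rw [Finset.sum_comm]
  refine Finset.sum_congr rfl fun j _ => ?_
  rw [Finset.sum_comm]
  refine Finset.sum_congr rfl fun l _ => ?_
  by_cases h : j = l
  · simp [h]
  · simp only [ne_eq, h, not_false_eq_true, if_true, signedCollision, mul_assoc,
      ← Finset.mul_sum]
    simp [eq_comm]

theorem sum_offDiag_sq_mul_sq {d : ℕ} (x : Fin d → ℝ) :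
    ∑ j, ∑ l, (if j ≠ l then x j ^ 2 * x l ^ 2 else 0)
      = (∑ j, x j ^ 2) ^ 2 - ∑ j, x j ^ 4 := by
  rw [sq (∑ j, x j ^ 2), Finset.sum_mul_sum, ← Finset.sum_sub_distrib]
  refine Finset.sum_congr rfl fun j _ => ?_
  rw [eq_sub_iff_add_eq, show x j ^ 4 = ∑ l, if j = l then x l ^ 4 else 0 by simp,
    ← Finset.sum_add_distrib]
  refine Finset.sum_congr rfl fun l _ => ?_
  by_cases h : j = l
  · subst h
    simp only [ne_eq, not_true_eq_false, if_false, if_true]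
    ring
  · simp [h]

/-- With the random hash and sign functions of the SJLT, for fixed
`x ∈ ℝ^d` the cross term
`b = Σ_i Σ_r Σ_{j ≠ ℓ} x_j x_ℓ φ_r(j) φ_r(ℓ) 1[h_r(j)=i] 1[h_r(ℓ)=i]`
satisfies `E[b²] = (2s²/k)·(‖x‖₂⁴ − ‖x‖₄⁴)` where `k = c·s`. -/
theorem sjlt_cross_term_second_moment
    {Ω : Type*} [MeasurableSpace Ω] (Pr : Measure Ω) [IsProbabilityMeasure Pr]
    (s c d : ℕ) [NeZero s] [NeZero c]
    (G : Ω → (Fin s × Fin d) → Fin c × ℝ) (hGmeas : Measurable G)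
    (hGlaw : Measure.map G Pr = Measure.pi (fun _ => hashSignMeasure c))
    (x : Fin d → ℝ) :
    (∫ ω, (∑ i : Fin c, ∑ r : Fin s, ∑ j : Fin d, ∑ l : Fin d,
        if j ≠ l then
          x j * x l * (G ω (r, j)).2 * (G ω (r, l)).2
            * (if (G ω (r, j)).1 = i then 1 else 0)
            * (if (G ω (r, l)).1 = i then 1 else 0)
        else 0) ^ 2 ∂Pr)
      = (2 * (s : ℝ) ^ 2 / ((c : ℝ) * (s : ℝ)))
        * ((∑ j, (x j) ^ 2) ^ 2 - ∑ j, (x j) ^ 4) := by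
  have hmeas : Measurable fun g : Fin s × Fin d → Fin c × ℝ =>
      (∑ a : Fin s × Fin d × Fin d, (if a.2.1 ≠ a.2.2 then x a.2.1 * x a.2.2 else 0) *
        signedCollision (g (a.1, a.2.1)) (g (a.1, a.2.2))) ^ 2 :=
    (Finset.measurable_sum _ fun a _ =>
      (measurable_signedCollision_eval (a.1, a.2.1) (a.1, a.2.2)).const_mul _).pow_const 2
  simp only [crossTerm_eq_sum_signedCollision]
  rw [← integral_map hGmeas.aemeasurable hmeas.aestronglyMeasurable, hGlaw,
    integral_sum_signedCollision_sq (fun a : Fin s × Fin d × Fin d => (a.1, a.2.1))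
      (fun a => (a.1, a.2.2)) (fun a => if a.2.1 ≠ a.2.2 then x a.2.1 * x a.2.2 else 0)
      (fun a ha => if_neg (not_not.2 (Prod.ext_iff.1 ha).2))]
  have hrow : ∀ a : Fin s × Fin d × Fin d,
      ∑ b : Fin s × Fin d × Fin d, (if a.2.1 ≠ a.2.2 then x a.2.1 * x a.2.2 else 0) *
        (if b.2.1 ≠ b.2.2 then x b.2.1 * x b.2.2 else 0) *
        ((c : ℝ)⁻¹ * ((if (a.1, a.2.1) = (b.1, b.2.1) ∧ (a.1, a.2.2) = (b.1, b.2.2) then 1 else 0)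
          + if (a.1, a.2.1) = (b.1, b.2.2) ∧ (a.1, a.2.2) = (b.1, b.2.1) then 1 else 0))
      = 2 * (c : ℝ)⁻¹ * if a.2.1 ≠ a.2.2 then x a.2.1 ^ 2 * x a.2.2 ^ 2 else 0 := by
    rintro ⟨r, j, l⟩
    have h₁ : ∀ b : Fin s × Fin d × Fin d,
        ((r, j) = (b.1, b.2.1) ∧ (r, l) = (b.1, b.2.2)) ↔ b = (r, j, l) := by
      rintro ⟨r', j', l'⟩
      grind
    have h₂ : ∀ b : Fin s × Fin d × Fin d,
        ((r, j) = (b.1, b.2.2) ∧ (r, l) = (b.1, b.2.1)) ↔ b = (r, l, j) := by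
      rintro ⟨r', j', l'⟩
      grind
    simp only [h₁, h₂, mul_add, Finset.sum_add_distrib, mul_ite, mul_one, mul_zero,
      Finset.sum_ite_eq', Finset.mem_univ, if_true]
    by_cases h : j = l
    · simp [h]
    · simp only [ne_eq, h, Ne.symm h, not_false_eq_true, if_true]
      ring
  rw [Finset.sum_congr rfl fun a _ => hrow a, ← Finset.mul_sum]
  simp only [Fintype.sum_prod_type, sum_offDiag_sq_mul_sq, Finset.sum_const, Finset.card_univ,
    Fintype.card_fin, nsmul_eq_mul]
  have hc : (c : ℝ) ≠ 0 := Nat.cast_ne_zero.2 (NeZero.ne c)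
  have hs : (s : ℝ) ≠ 0 := Nat.cast_ne_zero.2 (NeZero.ne s)
  field_simp
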